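/- arXiv:1905.08568 — 4 statements merged into one kernel-verified Lean document; each statement's English description precedes it below -/
import Mathlib

section
/- Let λ be a positive integer, let G be a finite abelian group of order 2λ+1, and let (A,B,C,D) be a skew Hadamard difference family with four blocks in G. Then for every nontrivial additive character χ : G → ℂ*, (4λ+3 − χ(A))·(4λ+3 − χ(−A)) + χ(B)·χ(−B) + χ(C)·χ(−C) + χ(D)·χ(−D) = (8λ+7)·(2λ+2). -/
open Matrix Finset Pointwise

/-- A skew Hadamard difference family with four blocks in a finite abelian group `G`
of order `2λ+1`. -/
def IsSDF4 {G : Type} [AddCommGroup G] [Fintype G] [DecidableEq G]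
    (lam : ℕ) (A B C D : Finset G) : Prop :=
  (A ∩ (-A) = ∅ ∧ A ∪ (-A) = Finset.univ \ {0}) ∧
  (B ∩ (-B) = ∅ ∧ B ∪ (-B) = Finset.univ \ {0}) ∧
  (C ∩ (-C) = ∅ ∧ C ∪ (-C) = Finset.univ \ {0}) ∧
  (D ∩ (-D) = ∅ ∧ D ∪ (-D) = Finset.univ \ {0}) ∧
  ∀ g : G, g ≠ 0 →
    ((A ×ˢ A).filter (fun p => p.1 - p.2 = g)).card
      + ((B ×ˢ B).filter (fun p => p.1 - p.2 = g)).card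
      + ((C ×ˢ C).filter (fun p => p.1 - p.2 = g)).card
      + ((D ×ˢ D).filter (fun p => p.1 - p.2 = g)).card = 2*(lam - 1)

/-- The adjacency matrix of the graph `W(G,A,B,C,D)`: the vertex `vᵢ` (i = 1,2,3) is
`Sum.inl (i-1)`, the vertex `a_g` is `Sum.inr (Sum.inl g)`, `b_g` is
`Sum.inr (Sum.inr (Sum.inl g))`, `c_g` is `Sum.inr (Sum.inr (Sum.inr (Sum.inl g)))`
and `d_g` is `Sum.inr (Sum.inr (Sum.inr (Sum.inr g)))`. -/
def wAdj {G : Type} [AddCommGroup G] [DecidableEq G] (A B C D : Finset G) :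
    Matrix (Fin 3 ⊕ G ⊕ G ⊕ G ⊕ G) (Fin 3 ⊕ G ⊕ G ⊕ G ⊕ G) ℤ :=
  Matrix.of fun v w =>
    match v, w with
    | Sum.inl _, Sum.inr (Sum.inl _) => 1
    | Sum.inl i, Sum.inr (Sum.inr (Sum.inl _)) => if i = 2 then 1 else 0
    | Sum.inl i, Sum.inr (Sum.inr (Sum.inr (Sum.inl _))) => if i = 0 then 1 else 0
    | Sum.inl i, Sum.inr (Sum.inr (Sum.inr (Sum.inr _))) => if i = 1 then 1 else 0
    | Sum.inr (Sum.inl g), Sum.inr (Sum.inl h) => if h - g ∈ A then 1 else 0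
    | Sum.inr (Sum.inl g), Sum.inr (Sum.inr (Sum.inl h)) => if h - g ∈ B ∪ {0} then 1 else 0
    | Sum.inr (Sum.inl g), Sum.inr (Sum.inr (Sum.inr (Sum.inl h))) =>
        if h + g ∈ (-C) ∪ {0} then 1 else 0
    | Sum.inr (Sum.inl g), Sum.inr (Sum.inr (Sum.inr (Sum.inr h))) =>
        if h - g ∈ D ∪ {0} then 1 else 0
    | Sum.inr (Sum.inr (Sum.inl _)), Sum.inl i => if i = 2 then 0 else 1
    | Sum.inr (Sum.inr (Sum.inl g)), Sum.inr (Sum.inl h) => if h - g ∈ B then 1 else 0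
    | Sum.inr (Sum.inr (Sum.inl g)), Sum.inr (Sum.inr (Sum.inl h)) =>
        if h - g ∈ -A then 1 else 0
    | Sum.inr (Sum.inr (Sum.inl g)), Sum.inr (Sum.inr (Sum.inr (Sum.inl h))) =>
        if h - g ∈ -D then 1 else 0
    | Sum.inr (Sum.inr (Sum.inl g)), Sum.inr (Sum.inr (Sum.inr (Sum.inr h))) =>
        if h + g ∈ C ∪ {0} then 1 else 0
    | Sum.inr (Sum.inr (Sum.inr (Sum.inl _))), Sum.inl i => if i = 0 then 0 else 1
    | Sum.inr (Sum.inr (Sum.inr (Sum.inl g))), Sum.inr (Sum.inl h) =>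
        if h + g ∈ C then 1 else 0
    | Sum.inr (Sum.inr (Sum.inr (Sum.inl g))), Sum.inr (Sum.inr (Sum.inl h)) =>
        if h - g ∈ (-D) ∪ {0} then 1 else 0
    | Sum.inr (Sum.inr (Sum.inr (Sum.inl g))), Sum.inr (Sum.inr (Sum.inr (Sum.inl h))) =>
        if h - g ∈ A then 1 else 0
    | Sum.inr (Sum.inr (Sum.inr (Sum.inl g))), Sum.inr (Sum.inr (Sum.inr (Sum.inr h))) =>
        if h - g ∈ B then 1 else 0
    | Sum.inr (Sum.inr (Sum.inr (Sum.inr _))), Sum.inl i => if i = 1 then 0 else 1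
    | Sum.inr (Sum.inr (Sum.inr (Sum.inr g))), Sum.inr (Sum.inl h) =>
        if h - g ∈ D then 1 else 0
    | Sum.inr (Sum.inr (Sum.inr (Sum.inr g))), Sum.inr (Sum.inr (Sum.inl h)) =>
        if h + g ∈ C then 1 else 0
    | Sum.inr (Sum.inr (Sum.inr (Sum.inr g))), Sum.inr (Sum.inr (Sum.inr (Sum.inl h))) =>
        if h - g ∈ B ∪ {0} then 1 else 0
    | Sum.inr (Sum.inr (Sum.inr (Sum.inr g))), Sum.inr (Sum.inr (Sum.inr (Sum.inr h))) =>
        if h - g ∈ -A then 1 else 0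
    | _, _ => 0

/-- The number of representations of `g` as a difference of two elements of `X`. -/
def diffCount {G : Type} [AddCommGroup G] [DecidableEq G] (X : Finset G) (g : G) : ℕ :=
  ((X ×ˢ X).filter (fun p => p.1 - p.2 = g)).card

theorem diffCount_zero {G : Type} [AddCommGroup G] [DecidableEq G] (X : Finset G) :
    diffCount X 0 = X.card := by
  have h : (X ×ˢ X).filter (fun p => p.1 - p.2 = 0) = X.diag := by
    ext ⟨a, b⟩
    simp only [mem_filter, mem_product, mem_diag, sub_eq_zero]
    grind
  rw [diffCount, h, diag_card]

theorem sum_mul_sum_neg_eq_sum_diffCount {G : Type} [AddCommGroup G] [Fintype G]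
    [DecidableEq G] (X : Finset G) (χ : AddChar G ℂ) :
    (∑ x ∈ X, χ x) * (∑ x ∈ X, χ (-x)) = ∑ g, (diffCount X g : ℂ) * χ g := by
  rw [sum_mul_sum, ← sum_product', ← sum_fiberwise _ (fun p : G × G => p.1 - p.2)]
  refine sum_congr rfl fun g _ => ?_
  rw [diffCount, ← nsmul_eq_mul, ← sum_const]
  refine sum_congr rfl fun p hp => ?_
  rw [← AddChar.map_add_eq_mul, ← sub_eq_add_neg, (mem_filter.mp hp).2]

theorem sum_add_sum_neg_of_skew {G : Type} [AddCommGroup G] [Fintype G] [DecidableEq G]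
    {X : Finset G} (h : X ∩ (-X) = ∅ ∧ X ∪ (-X) = univ \ {0}) {M : Type*} [AddCommGroup M]
    (f : G → M) : ∑ x ∈ X, f x + ∑ x ∈ X, f (-x) = ∑ x, f x - f 0 := by
  have hneg : ∑ x ∈ X, f (-x) = ∑ x ∈ -X, f x := by
    rw [← Finset.image_neg_eq_neg, sum_image neg_injective.injOn]
  rw [hneg, ← sum_union (disjoint_iff_inter_eq_empty.mpr h.1), h.2, eq_sub_iff_add_eq]
  simp

theorem card_of_skew {G : Type} [AddCommGroup G] [Fintype G] [DecidableEq G] {n : ℕ}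
    (hG : Fintype.card G = 2 * n + 1) {X : Finset G}
    (h : X ∩ (-X) = ∅ ∧ X ∪ (-X) = univ \ {0}) : X.card = n := by
  have := sum_add_sum_neg_of_skew h (fun _ => (1 : ℤ))
  simp only [sum_const, nsmul_eq_mul, mul_one, card_univ, hG] at this
  omega

theorem w_character_identity {G : Type} [AddCommGroup G] [Fintype G] [DecidableEq G]
    (lam : ℕ) (hlam : 0 < lam) (hG : Fintype.card G = 2*lam+1)
    (A B C D : Finset G) (hSDF : IsSDF4 lam A B C D)
    (χ : AddChar G ℂ) (hχ : ∃ g : G, χ g ≠ 1) :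
    ((4*(lam:ℂ)+3) - ∑ x ∈ A, χ x) * ((4*(lam:ℂ)+3) - ∑ x ∈ A, χ (-x))
      + (∑ x ∈ B, χ x) * (∑ x ∈ B, χ (-x))
      + (∑ x ∈ C, χ x) * (∑ x ∈ C, χ (-x))
      + (∑ x ∈ D, χ x) * (∑ x ∈ D, χ (-x)) = (8*(lam:ℂ)+7) * (2*(lam:ℂ)+2) := by
  obtain ⟨hA, hB, hC, hD, hdiff⟩ := hSDF
  have hχ0 : χ ≠ 0 := by
    rintro rfl
    simp at hχ
  have hsum : ∑ g, χ g = 0 := AddChar.sum_eq_zero_iff_ne_zero.mpr hχ0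
  have hskew : ∑ x ∈ A, χ x + ∑ x ∈ A, χ (-x) = -1 := by
    rw [sum_add_sum_neg_of_skew hA, hsum, AddChar.map_zero_eq_one, zero_sub]
  have hcount : ∀ g : G, ((diffCount A g : ℂ) + diffCount B g + diffCount C g + diffCount D g)
      = 2 * ((lam : ℂ) - 1) + if g = 0 then 2 * (lam : ℂ) + 2 else 0 := by
    intro g
    split_ifs with hg
    · subst hg
      simp only [diffCount_zero, card_of_skew hG hA, card_of_skew hG hB, card_of_skew hG hC,
        card_of_skew hG hD]
      ring
    · have h : diffCount A g + diffCount B g + diffCount C g + diffCount D g = 2 * (lam - 1) :=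
        hdiff g hg
      have h' := congrArg (Nat.cast : ℕ → ℂ) h
      push_cast [Nat.cast_sub (Nat.one_le_of_lt hlam)] at h'
      rw [h', add_zero]
  have hnorm : (∑ x ∈ A, χ x) * (∑ x ∈ A, χ (-x)) + (∑ x ∈ B, χ x) * (∑ x ∈ B, χ (-x))
      + (∑ x ∈ C, χ x) * (∑ x ∈ C, χ (-x)) + (∑ x ∈ D, χ x) * (∑ x ∈ D, χ (-x))
      = 2 * (lam : ℂ) + 2 := by
    simp only [sum_mul_sum_neg_eq_sum_diffCount, ← sum_add_distrib, ← add_mul, hcount]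
    simp only [add_mul _ (ite _ _ _), sum_add_distrib, ← mul_sum, hsum, ite_mul, zero_mul]
    simp
  linear_combination hnorm - (4 * (lam : ℂ) + 3) * hskew
end

section
/- Let F be a finite field with q elements where q ≡ 3 (mod 4), let k = (q−1)/2, let H ⊆ F be the set of nonzero squares, and let ψ be the quadratic multiplicative character of F. Let φ be a multiplicative character of F with values in ℂ such that φ is nontrivial and φ ≠ ψ. Then for every z ∈ F: 2·( k·φ(z) − Σ_{y∈H} φ(z−y) ) = q·φ(z) − J(φ,ψ)·φ(z)·ψ(z), where J(φ,ψ) = Σ_{x∈F} φ(x)·ψ(1−x) is the Jacobi sum. -/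
open Finset

/-- The additive convolution of two multiplicative characters whose product is nontrivial
is a multiple of their product by the Jacobi sum. -/
theorem sum_mulChar_sub_mul_mulChar {F R : Type*} [Field F] [Fintype F] [CommRing R] [IsDomain R]
    (φ ψ : MulChar F R) (h : φ * ψ ≠ 1) (z : F) :
    ∑ y, φ (z - y) * ψ y = φ z * ψ z * jacobiSum φ ψ := by
  rcases eq_or_ne z 0 with rfl | hz
  · have key : ∀ y : F, φ (0 - y) * ψ y = φ (-1) * (φ * ψ) y := by
      intro y
      rw [MulChar.mul_apply, zero_sub, neg_eq_neg_one_mul y, map_mul, mul_assoc]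
    simp only [key, ← Finset.mul_sum, MulChar.sum_eq_zero_of_ne_one h]
    simp [MulChar.map_zero]
  · rw [jacobiSum, Finset.mul_sum]
    symm
    refine Fintype.sum_equiv ((Equiv.mulLeft₀ z hz).trans (Equiv.subLeft z)) _ _ fun x => ?_
    have h₁ : z - (z - z * x) = z * x := by ring
    have h₂ : z - z * x = z * (1 - x) := by ring
    change _ = φ (z - (z - z * x)) * ψ (z - z * x)
    rw [h₁, h₂, map_mul, map_mul]
    ring

theorem paley_character_row (F : Type) [Field F] [Fintype F] [DecidableEq F]
    (hq : Fintype.card F % 4 = 3)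
    (φ ψ : MulChar F ℂ)
    (hψ : ∀ x : F, ψ x = if x = 0 then 0 else if ∃ r : F, r^2 = x then 1 else -1)
    (hφ : φ ≠ 1) (hφψ : φ ≠ ψ) :
    ∀ z : F,
      2 * (((((Fintype.card F - 1)/2 : ℕ) : ℂ)) * φ z
          - ∑ y ∈ Finset.univ.filter (fun y : F => ∃ r : F, r ≠ 0 ∧ r^2 = y), φ (z - y))
        = (Fintype.card F : ℂ) * φ z
          - (∑ x : F, φ x * ψ (1 - x)) * φ z * ψ z := by
  intro z
  have hψψ : ψ * ψ = 1 := by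
    ext a
    rw [MulChar.mul_apply, MulChar.one_apply_coe, hψ, if_neg a.ne_zero]
    split_ifs <;> norm_num
  have hne : φ * ψ ≠ 1 := by
    intro h
    exact hφψ (mul_right_cancel (h.trans hψψ.symm))
  have hk : 2 * (((Fintype.card F - 1) / 2 : ℕ) : ℂ) = (Fintype.card F : ℂ) - 1 := by
    have : 2 * ((Fintype.card F - 1) / 2) + 1 = Fintype.card F := by omega
    rw [eq_sub_iff_add_eq]
    exact_mod_cast this
  have hsum : ∑ y, φ (z - y) = 0 := by
    rw [← MulChar.sum_eq_zero_of_ne_one hφ]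
    exact Fintype.sum_equiv (Equiv.subLeft z) _ _ fun _ => rfl
  have hind : ∀ y : F, 2 * (if ∃ r : F, r ≠ 0 ∧ r ^ 2 = y then φ (z - y) else 0)
      = φ (z - y) + φ (z - y) * ψ y - (if y = 0 then φ (z - y) else 0) := by
    intro y
    rw [hψ]
    rcases eq_or_ne y 0 with rfl | hy
    · simp
    · have hiff : (∃ r : F, r ≠ 0 ∧ r ^ 2 = y) ↔ ∃ r : F, r ^ 2 = y := by
        refine ⟨fun ⟨r, _, h⟩ => ⟨r, h⟩, fun ⟨r, h⟩ => ⟨r, ?_, h⟩⟩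
        rintro rfl
        exact hy (by simpa using h.symm)
      simp only [hiff, hy, if_false]
      split_ifs <;> ring
  have hH : 2 * ∑ y ∈ Finset.univ.filter (fun y : F => ∃ r : F, r ≠ 0 ∧ r^2 = y), φ (z - y)
      = φ z * ψ z * jacobiSum φ ψ - φ z := by
    rw [Finset.sum_filter, Finset.mul_sum, Finset.sum_congr rfl fun y _ => hind y,
      Finset.sum_sub_distrib, Finset.sum_add_distrib, hsum,
      sum_mulChar_sub_mul_mulChar φ ψ hne]
    simp
  rw [jacobiSum] at hH
  linear_combination φ z * hk - hH
end

section
/- Let p be an odd prime and t a positive integer with q := p^t ≡ 3 (mod 4), and let k = (q−1)/2. For an integer i with 1 ≤ i ≤ q−2 and i ≠ k, let c(i) = ( s(i) + s(k) − s((i+k) mod (q−1)) ) / (p−1), where s(n) denotes the sum of the base-p digits of n; c(i) is the number of carries when adding the base-p expansions of i and k modulo q−1. Then the number of i ∈ {1,…,q−2}∖{k} with c(i) = t equals ((p+1)/2)^t − 2, and for each a with 1 ≤ a < t, the number of i ∈ {1,…,q−2}∖{k} with c(i) = a equals Σ_{j=0}^{min(a, t−a)} (t/(t−j))·C(t−j,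 j)·C(t−2j, a−j)·(−p)^j·((p+1)/2)^(t−2j), where C(n,k) denotes the binomial coefficient. -/
open Finset

namespace CyclicCarry

open Polynomial

/-- The carry leaving position `t` when the number with all base-`p` digits equal to `h` is added
to `n`, with initial carry `e`. -/
def carryOut (p h : ℕ) : ℕ → ℕ → ℕ → ℕ
  | 0, _, e => e
  | t + 1, n, e => carryOut p h t (n / p) ((n % p + h + e) / p)

/-- The number of carries produced in the first `t` positions when the number with all base-`p`
digits equal to `h` is added to `n`, with initial carry `e`. -/
def carryCount (p h : ℕ) : ℕ → ℕ → ℕ → ℕ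
  | 0, _, _ => 0
  | t + 1, n, e =>
    (n % p + h + e) / p + carryCount p h t (n / p) ((n % p + h + e) / p)

/-- The number with `t` base-`p` digits, all equal to `d`. -/
def repdigit (p d : ℕ) : ℕ → ℕ
  | 0 => 0
  | t + 1 => d + p * repdigit p d t

lemma repdigit_mul_pred (p d t : ℕ) (hp : 1 ≤ p) :
    repdigit p d t * (p - 1) = d * (p ^ t - 1) := by
  obtain ⟨m, rfl⟩ := Nat.exists_eq_add_of_le' hp
  have h1 : 1 ≤ (m + 1) ^ t := Nat.one_le_pow _ _ (by omega)
  suffices h : repdigit (m + 1) d t * m + d = d * (m + 1) ^ t by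
    rw [Nat.add_sub_cancel, Nat.mul_sub, mul_one]
    omega
  clear h1
  induction t with
  | zero => simp [repdigit]
  | succ t ih =>
    rw [repdigit, pow_succ]
    linear_combination (m + 1) * ih

lemma carryCount_repdigit (p h d e t : ℕ) (hd : d < p) (he : (d + h + e) / p = e) :
    carryCount p h t (repdigit p d t) e = t * e := by
  induction t with
  | zero => simp [carryCount]
  | succ t ih =>
    have h1 : (d + p * repdigit p d t) % p = d := by
      rw [Nat.add_mul_mod_self_left, Nat.mod_eq_of_lt hd]
    have h2 : (d + p * repdigit p d t) / p = repdigit p d t := by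
      rw [Nat.add_mul_div_left _ _ (by omega), Nat.div_eq_of_lt hd, zero_add]
    rw [repdigit, carryCount, h1, h2, he, ih]
    ring

lemma digits_sum_add_mul (p d m : ℕ) (hp : 1 < p) (hd : d < p) :
    (Nat.digits p (d + p * m)).sum = d + (Nat.digits p m).sum := by
  by_cases h : d = 0 ∧ m = 0
  · simp [h.1, h.2]
  · rw [Nat.digits_add p hp d m hd (by omega), List.sum_cons]

lemma exists_add_repdigit (p h : ℕ) (hp : 1 < p) (t n e : ℕ) (hn : n < p ^ t) :
    ∃ r < p ^ t, n + repdigit p h t + e = r + p ^ t * carryOut p h t n e ∧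
      (Nat.digits p n).sum + h * t + e =
        (Nat.digits p r).sum + (p - 1) * carryCount p h t n e + carryOut p h t n e := by
  induction t generalizing n e with
  | zero =>
    obtain rfl : n = 0 := by simpa using hn
    exact ⟨0, by simp, by simp [repdigit, carryOut], by simp [carryCount, carryOut]⟩
  | succ t ih =>
    obtain ⟨d, m, hd, rfl⟩ : ∃ d m, d < p ∧ n = d + p * m :=
      ⟨n % p, n / p, Nat.mod_lt _ (by omega), (Nat.mod_add_div n p).symm⟩
    have h1 : (d + p * m) % p = d := by
      rw [Nat.add_mul_mod_self_left, Nat.mod_eq_of_lt hd]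
    have h2 : (d + p * m) / p = m := by
      rw [Nat.add_mul_div_left _ _ (by omega), Nat.div_eq_of_lt hd, zero_add]
    have hm : m < p ^ t := by
      rw [pow_succ'] at hn
      exact lt_of_mul_lt_mul_left (by omega) (Nat.zero_le p)
    simp only [carryOut, carryCount, repdigit, h1, h2]
    set c := (d + h + e) / p with hc
    set x := (d + h + e) % p with hx
    have hxc : x + p * c = d + h + e := Nat.mod_add_div _ _
    have hxp : x < p := Nat.mod_lt _ (by omega)
    obtain ⟨r, hr, hsum, hdig⟩ := ih m c hm
    refine ⟨x + p * r, ?_, ?_, ?_⟩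
    · rw [pow_succ']
      nlinarith
    · rw [pow_succ']
      linear_combination p * hsum - hxc
    · rw [digits_sum_add_mul p d m hp hd, digits_sum_add_mul p x r hp hxp]
      obtain ⟨b, rfl⟩ := Nat.exists_eq_add_of_le' hp.le
      simp only [Nat.add_sub_cancel] at hdig ⊢
      linear_combination hdig - hxc

/-- The generating function, by number of carries, of the `n < p ^ t` which turn the initial
carry `e` into the final carry `f`. -/
noncomputable def carryPoly (p h t e f : ℕ) : ℚ[X] :=
  ∑ n ∈ range (p ^ t), if carryOut p h t n e = f then X ^ carryCount p h t n e else 0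

lemma coeff_carryPoly (p h t e f a : ℕ) :
    (carryPoly p h t e f).coeff a =
      #{n ∈ range (p ^ t) | carryOut p h t n e = f ∧ carryCount p h t n e = a} := by
  rw [carryPoly, finsetSum_coeff, card_filter, Nat.cast_sum]
  refine sum_congr rfl fun n _ => ?_
  by_cases h1 : carryOut p h t n e = f <;> simp [h1, coeff_X_pow, eq_comm]

lemma sum_range_mul {M : Type*} [AddCommMonoid M] (p m : ℕ) (F : ℕ → M) :
    ∑ n ∈ range (p * m), F n = ∑ d ∈ range p, ∑ k ∈ range m, F (d + p * k) := by
  rw [sum_comm]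
  induction m with
  | zero => simp
  | succ m ih =>
    rw [Nat.mul_succ, sum_range_add, ih, sum_range_succ]
    simp only [add_comm]

lemma carryPoly_succ (p h t e f : ℕ) :
    carryPoly p h (t + 1) e f =
      ∑ d ∈ range p, X ^ ((d + h + e) / p) * carryPoly p h t ((d + h + e) / p) f := by
  rw [carryPoly, pow_succ', sum_range_mul]
  refine sum_congr rfl fun d hd => ?_
  rw [mem_range] at hd
  rw [carryPoly, mul_sum]
  refine sum_congr rfl fun k _ => ?_
  have h1 : (d + p * k) % p = d := by
    rw [Nat.add_mul_mod_self_left, Nat.mod_eq_of_lt hd]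
  have h2 : (d + p * k) / p = k := by
    rw [Nat.add_mul_div_left _ _ (by omega), Nat.div_eq_of_lt hd, zero_add]
  simp only [carryOut, carryCount, h1, h2, pow_add, mul_ite, mul_zero]

lemma carryPoly_succ_zero (h t f : ℕ) :
    carryPoly (2 * h + 1) h (t + 1) 0 f =
      ((h + 1 : ℕ) : ℚ[X]) * carryPoly (2 * h + 1) h t 0 f +
        (h : ℚ[X]) * X * carryPoly (2 * h + 1) h t 1 f := by
  rw [carryPoly_succ, show range (2 * h + 1) = range ((h + 1) + h) by congr 1; omega,
    sum_range_add]
  congr 1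
  · rw [sum_congr rfl (g := fun _ => carryPoly (2 * h + 1) h t 0 f)]
    · simp
    · intro d hd
      rw [mem_range] at hd
      rw [Nat.div_eq_of_lt (by omega)]
      simp
  · rw [sum_congr rfl (g := fun _ => X * carryPoly (2 * h + 1) h t 1 f)]
    · simp [mul_assoc]
    · intro d hd
      rw [mem_range] at hd
      rw [show (h + 1 + d + h + 0) / (2 * h + 1) = 1 from
        Nat.div_eq_of_lt_le (by omega) (by omega)]
      simp

lemma carryPoly_succ_one (h t f : ℕ) :
    carryPoly (2 * h + 1) h (t + 1) 1 f =
      (h : ℚ[X]) * carryPoly (2 * h + 1) h t 0 f +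
        ((h + 1 : ℕ) : ℚ[X]) * X * carryPoly (2 * h + 1) h t 1 f := by
  rw [carryPoly_succ, show range (2 * h + 1) = range (h + (h + 1)) by congr 1; omega,
    sum_range_add]
  congr 1
  · rw [sum_congr rfl (g := fun _ => carryPoly (2 * h + 1) h t 0 f)]
    · simp
    · intro d hd
      rw [mem_range] at hd
      rw [Nat.div_eq_of_lt (by omega)]
      simp
  · rw [sum_congr rfl (g := fun _ => X * carryPoly (2 * h + 1) h t 1 f)]
    · simp [mul_assoc]
    · intro d hd
      rw [mem_range] at hd
      rw [show (h + d + h + 1) / (2 * h + 1) = 1 from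
        Nat.div_eq_of_lt_le (by omega) (by omega)]
      simp

/-- The bivariate Fibonacci polynomial with parameters `u`, `v`. -/
def fibSum {R : Type*} [CommRing R] (u v : R) (t : ℕ) : R :=
  ∑ x ∈ antidiagonal t, (x.1.choose x.2 : R) * v ^ x.2 * u ^ (x.1 - x.2)

lemma fibSum_add_two {R : Type*} [CommRing R] (u v : R) (t : ℕ) :
    fibSum u v (t + 2) = u * fibSum u v (t + 1) + v * fibSum u v t := by
  have hu : u * fibSum u v (t + 1) = u ^ (t + 2) +
      ∑ x ∈ antidiagonal t, (x.1.choose (x.2 + 1) : R) * v ^ (x.2 + 1) * u ^ (x.1 - x.2) := by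
    rw [fibSum, Nat.sum_antidiagonal_succ', mul_add, mul_sum]
    congr 1
    · simp [pow_succ']
    · refine sum_congr rfl fun x _ => ?_
      by_cases hx : x.2 + 1 ≤ x.1
      · rw [show x.1 - x.2 = (x.1 - (x.2 + 1)) + 1 by omega]
        ring
      · simp [Nat.choose_eq_zero_of_lt (not_le.mp hx)]
  rw [hu, fibSum, fibSum, Nat.antidiagonal_succ_succ']
  simp only [sum_cons, sum_map, mul_sum, Function.Embedding.prodMap, Function.Embedding.coeFn_mk,
    Prod.map, Nat.succ_eq_add_one, Nat.choose_zero_right, Nat.choose_succ_succ, Nat.choose_zero_succ,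
    Nat.add_sub_add_right, Nat.cast_add]
  simp only [Nat.cast_zero, Nat.cast_one, add_mul, sum_add_distrib, pow_succ]
  simp only [mul_comm, mul_left_comm, mul_assoc]
  simp
  ring

lemma fibSum_eq_sum_range {R : Type*} [CommRing R] (u v : R) (t : ℕ) :
    fibSum u v t =
      ∑ j ∈ range (t + 1), ((t - j).choose j : R) * v ^ j * u ^ (t - 2 * j) := by
  rw [fibSum, Nat.sum_antidiagonal_eq_sum_range_succ_mk, ← sum_range_reflect]
  refine sum_congr rfl fun j hj => ?_
  rw [mem_range] at hj
  rw [show t.succ - 1 - j = t - j by omega, show t - (t - j) = j by omega,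
    show t - j - j = t - 2 * j by omega]

lemma eq_fibSum_of_rec {R : Type*} [CommRing R] (u v : R) (T : ℕ → R) (h0 : T 0 = 2)
    (h1 : T 1 = u) (hT : ∀ t, T (t + 2) = u * T (t + 1) + v * T t) (t : ℕ) :
    T (t + 2) = fibSum u v (t + 2) + v * fibSum u v t := by
  induction t using Nat.twoStepInduction with
  | zero =>
    rw [hT, h0, h1, fibSum_add_two]
    simp [fibSum, Nat.antidiagonal_succ]
    ring
  | one =>
    rw [hT, hT, h0, h1, fibSum_add_two, fibSum_add_two]
    simp [fibSum, Nat.antidiagonal_succ]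
    ring
  | more t ih1 ih2 =>
    rw [hT, ih1, ih2, fibSum_add_two u v (t + 2), fibSum_add_two u v t, fibSum_add_two u v (t + 1),
      fibSum_add_two u v t]
    ring

lemma div_mul_choose (t j : ℕ) (hj : j < t) :
    (t + 1 : ℚ) / ((t + 1 - (j + 1) : ℕ) : ℚ) * ((t + 1 - (j + 1)).choose (j + 1) : ℚ) =
      ((t + 1 - (j + 1)).choose (j + 1) : ℚ) + ((t - 1 - j).choose j : ℚ) := by
  obtain ⟨m, rfl⟩ := Nat.exists_eq_add_of_lt hj
  rw [show j + m + 1 + 1 - (j + 1) = m + 1 by omega, show j + m + 1 - 1 - j = m by omega]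
  have h := Nat.add_one_mul_choose_eq m j
  have h' : ((m : ℚ) + 1) * (m.choose j : ℚ) = ((m + 1).choose (j + 1) : ℚ) * (j + 1) := by
    exact_mod_cast h
  push_cast
  field_simp
  linear_combination -h'

lemma lucas_closed_form {R : Type*} [CommRing R] [Algebra ℚ R] (u v : R) (T : ℕ → R)
    (h0 : T 0 = 2) (h1 : T 1 = u) (hT : ∀ t, T (t + 2) = u * T (t + 1) + v * T t)
    (t : ℕ) (ht : 0 < t) :
    T t = ∑ j ∈ range t, algebraMap ℚ R ((t : ℚ) / ((t - j : ℕ) : ℚ) * ((t - j).choose j : ℚ)) *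
      v ^ j * u ^ (t - 2 * j) := by
  obtain rfl | ⟨t, rfl⟩ : t = 1 ∨ ∃ s, t = s + 2 := by
    rcases t with _ | _ | t
    · omega
    · simp
    · exact Or.inr ⟨t, rfl⟩
  · simp [h1]
  · rw [eq_fibSum_of_rec u v T h0 h1 hT, fibSum_eq_sum_range, fibSum_eq_sum_range,
      sum_range_succ, sum_range_succ', sum_range_succ' (n := t + 1), mul_sum]
    have hlast : (((t + 2 - (t + 2)).choose (t + 2) : ℕ) : R) = 0 := by simp
    rw [hlast, zero_mul, zero_mul, add_zero, add_right_comm, ← sum_add_distrib]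
    congr 1
    · refine sum_congr rfl fun j hj => ?_
      rw [mem_range] at hj
      have h := div_mul_choose (t + 1) j hj
      rw [show ((t + 2 : ℕ) : ℚ) = ((t + 1 : ℕ) : ℚ) + 1 by push_cast; ring, h,
        show t + 1 + 1 - (j + 1) = t + 2 - (j + 1) by omega, map_add, map_natCast, map_natCast,
        show t + 1 - 1 - j = t - j by omega, show t + 2 - 2 * (j + 1) = t - 2 * j by omega]
      ring
    · have : ((t + 2 : ℕ) : ℚ) ≠ 0 := by positivity
      simp only [Nat.sub_zero, div_self this]
      simp

lemma coeff_carryPoly_trace (h t a : ℕ) (ht : 0 < t) :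
    (carryPoly (2 * h + 1) h t 0 0 + carryPoly (2 * h + 1) h t 1 1).coeff a =
      ∑ j ∈ range t, if j ≤ a then (t : ℚ) / ((t - j : ℕ) : ℚ) * ((t - j).choose j : ℚ)
        * ((t - 2 * j).choose (a - j) : ℚ) * (-((2 * h + 1 : ℕ) : ℚ)) ^ j
        * ((h + 1 : ℕ) : ℚ) ^ (t - 2 * j) else 0 := by
  have key := lucas_closed_form (C ((h + 1 : ℕ) : ℚ) * (1 + X)) (C (-((2 * h + 1 : ℕ) : ℚ)) * X)
    (fun t => carryPoly (2 * h + 1) h t 0 0 + carryPoly (2 * h + 1) h t 1 1)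
    (by simp [carryPoly, carryOut, carryCount]; norm_num)
    (by
      rw [← zero_add 1, carryPoly_succ_zero, carryPoly_succ_one]
      simp [carryPoly, carryOut, carryCount]
      ring)
    (by
      intro t
      simp only [carryPoly_succ_zero, carryPoly_succ_one]
      simp only [map_neg, map_natCast]
      push_cast
      ring) t ht
  rw [key, finsetSum_coeff]
  refine sum_congr rfl fun j _ => ?_
  have : algebraMap ℚ ℚ[X] ((t : ℚ) / ((t - j : ℕ) : ℚ) * ((t - j).choose j : ℚ)) *
      (C (-((2 * h + 1 : ℕ) : ℚ)) * X) ^ j * (C ((h + 1 : ℕ) : ℚ) * (1 + X)) ^ (t - 2 * j) =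
      C ((t : ℚ) / ((t - j : ℕ) : ℚ) * ((t - j).choose j : ℚ) * (-((2 * h + 1 : ℕ) : ℚ)) ^ j *
        ((h + 1 : ℕ) : ℚ) ^ (t - 2 * j)) * (X ^ j * (1 + X) ^ (t - 2 * j)) := by
    simp only [mul_pow, algebraMap_eq, C_mul, C_pow]
    ring
  rw [this, coeff_C_mul, coeff_X_pow_mul']
  split_ifs
  · rw [coeff_one_add_X_pow]
    ring
  · simp

lemma card_add_eq_coeff (h t : ℕ) (hh : 0 < h) (ht : 0 < t) (c : ℕ → ℕ)
    (hc : ∀ i, c i = ((Nat.digits (2 * h + 1) i).sum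
      + (Nat.digits (2 * h + 1) (repdigit (2 * h + 1) h t)).sum
      - (Nat.digits (2 * h + 1) ((i + repdigit (2 * h + 1) h t) %
          (2 * repdigit (2 * h + 1) h t))).sum) / (2 * h))
    (hq : (2 * h + 1) ^ t = 2 * repdigit (2 * h + 1) h t + 1) (a : ℕ) (ha : 0 < a) :
    ((#{i ∈ Icc 1 (2 * repdigit (2 * h + 1) h t - 1) |
        i ≠ repdigit (2 * h + 1) h t ∧ c i = a} + if a = t then 2 else 0 : ℕ) : ℚ) =
      (carryPoly (2 * h + 1) h t 0 0 + carryPoly (2 * h + 1) h t 1 1).coeff a := by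
  have spec := exists_add_repdigit (2 * h + 1) h (by omega) t
  have c00 := carryCount_repdigit (2 * h + 1) h 0 0 t (by omega) (Nat.div_eq_of_lt (by omega))
  have ck0 := carryCount_repdigit (2 * h + 1) h h 0 t (by omega) (Nat.div_eq_of_lt (by omega))
  have ck1 := carryCount_repdigit (2 * h + 1) h h 1 t (by omega)
    (Nat.div_eq_of_lt_le (by omega) (by omega))
  have cq1 := carryCount_repdigit (2 * h + 1) h (2 * h) 1 t (by omega)
    (Nat.div_eq_of_lt_le (by omega) (by omega))
  have e0 : repdigit (2 * h + 1) 0 t = 0 := by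
    have := repdigit_mul_pred (2 * h + 1) 0 t (by omega)
    simp at this
    omega
  have eq : repdigit (2 * h + 1) (2 * h) t = 2 * repdigit (2 * h + 1) h t := by
    have := repdigit_mul_pred (2 * h + 1) (2 * h) t (by omega)
    rw [Nat.add_sub_cancel, mul_comm] at this
    have := Nat.eq_of_mul_eq_mul_left (by omega) this
    omega
  rw [e0] at c00
  rw [eq] at cq1
  clear e0 eq
  have hk : 0 < repdigit (2 * h + 1) h t := by
    obtain ⟨t, rfl⟩ := Nat.exists_eq_add_of_le' ht
    rw [repdigit]
    omega
  rw [hq] at spec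
  set k := repdigit (2 * h + 1) h t
  have hdk : (Nat.digits (2 * h + 1) k).sum = h * t := by
    obtain ⟨r, hr, h1, h2⟩ := spec 0 0 (by omega)
    rw [c00] at h2
    have hz : carryOut (2 * h + 1) h t 0 0 = 0 := by
      by_contra hne
      have := Nat.le_mul_of_pos_right (2 * k + 1) (Nat.pos_of_ne_zero hne)
      omega
    rw [hz] at h1 h2
    obtain rfl : k = r := by omega
    simpa using h2.symm
  have out_zero (n : ℕ) (hn : n < 2 * k + 1) : carryOut (2 * h + 1) h t n 0 = 0 ↔ n ≤ k := by
    obtain ⟨r, hr, h1, -⟩ := spec n 0 hn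
    constructor
    · intro hz
      rw [hz] at h1
      omega
    · intro hle
      by_contra hne
      have := Nat.le_mul_of_pos_right (2 * k + 1) (Nat.pos_of_ne_zero hne)
      omega
  have out_one (n : ℕ) (hn : n < 2 * k + 1) : carryOut (2 * h + 1) h t n 1 = 1 ↔ k ≤ n := by
    obtain ⟨r, hr, h1, -⟩ := spec n 1 hn
    constructor
    · intro hz
      rw [hz] at h1
      omega
    · intro hle
      have h3 : carryOut (2 * h + 1) h t n 1 ≠ 0 := by
        intro hz
        rw [hz] at h1
        omega
      have h4 : carryOut (2 * h + 1) h t n 1 < 2 := by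
        by_contra hge
        have := Nat.mul_le_mul_left (2 * k + 1) (not_lt.mp hge)
        omega
      omega
  have c_low (n : ℕ) (hn : n < k) : c n = carryCount (2 * h + 1) h t n 0 := by
    obtain ⟨r, hr, h1, h2⟩ := spec n 0 (by omega)
    rw [(out_zero n (by omega)).2 hn.le] at h1 h2
    obtain rfl : r = n + k := by omega
    rw [hc, Nat.mod_eq_of_lt (by omega), hdk]
    refine Nat.div_eq_of_eq_mul_right (by omega) ?_
    simp only [Nat.add_sub_cancel] at h2
    omega
  have c_high (n : ℕ) (hn : k < n) (hn' : n < 2 * k) :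
      c n = carryCount (2 * h + 1) h t n 1 := by
    obtain ⟨r, hr, h1, h2⟩ := spec n 1 (by omega)
    rw [(out_one n (by omega)).2 hn.le] at h1 h2
    obtain rfl : r = n - k := by omega
    rw [hc, show n + k = (n - k) + 2 * k by omega, Nat.add_mod_right,
      Nat.mod_eq_of_lt (by omega), hdk]
    refine Nat.div_eq_of_eq_mul_right (by omega) ?_
    simp only [Nat.add_sub_cancel] at h2
    omega
  rw [coeff_add, coeff_carryPoly, coeff_carryPoly, ← Nat.cast_add, hq, Nat.cast_inj]
  have hlow : {n ∈ range (2 * k + 1) |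
      carryOut (2 * h + 1) h t n 0 = 0 ∧ carryCount (2 * h + 1) h t n 0 = a} =
      {i ∈ Icc 1 (2 * k - 1) | (i ≠ k ∧ c i = a) ∧ i < k} := by
    ext n
    simp only [mem_filter, mem_range, mem_Icc]
    constructor
    · rintro ⟨hn, h1, h2⟩
      rw [out_zero n hn] at h1
      have hn0 : n ≠ 0 := by
        rintro rfl
        omega
      have hnk : n ≠ k := by
        rintro rfl
        omega
      exact ⟨by omega, ⟨hnk, by rw [c_low n (by omega), h2]⟩, by omega⟩
    · rintro ⟨hn, ⟨-, h2⟩, hlt⟩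
      exact ⟨by omega, (out_zero n (by omega)).2 hlt.le, by rw [← c_low n hlt, h2]⟩
  have hhigh : {n ∈ range (2 * k + 1) |
      carryOut (2 * h + 1) h t n 1 = 1 ∧ carryCount (2 * h + 1) h t n 1 = a} =
      {i ∈ Icc 1 (2 * k - 1) | (i ≠ k ∧ c i = a) ∧ ¬ i < k} ∪
        if a = t then {k, 2 * k} else ∅ := by
    ext n
    rw [mem_union]
    have hite : n ∈ (if a = t then {k, 2 * k} else ∅ : Finset ℕ) ↔
        a = t ∧ (n = k ∨ n = 2 * k) := by
      split_ifs with hat <;> simp [hat]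
    rw [hite]
    simp only [mem_filter, mem_range, mem_Icc]
    constructor
    · rintro ⟨hn, h1, h2⟩
      rw [out_one n hn] at h1
      by_cases hnk : n = k
      · subst hnk
        right
        omega
      by_cases hnq : n = 2 * k
      · subst hnq
        right
        omega
      left
      exact ⟨by omega, ⟨hnk, by rw [c_high n (by omega) (by omega), h2]⟩, by omega⟩
    · rintro (⟨hn, ⟨hnk, h2⟩, hlt⟩ | ⟨rfl, rfl | rfl⟩)
      · exact ⟨by omega, (out_one n (by omega)).2 (by omega),
          by rw [← c_high n (by omega) (by omega), h2]⟩
      · exact ⟨by omega, (out_one _ (by omega)).2 le_rfl, by omega⟩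
      · exact ⟨by omega, (out_one _ (by omega)).2 (by omega), by omega⟩
  rw [hlow, hhigh, card_union_of_disjoint, ← add_assoc]
  · congr 1
    · rw [← card_filter_add_card_filter_not (p := fun i => i < k), filter_filter, filter_filter]
    · split_ifs
      · rw [card_pair (by omega)]
      · simp
  · rw [disjoint_left]
    intro n hn
    simp only [mem_filter, mem_Icc] at hn
    split_ifs
    · simp only [mem_insert, mem_singleton]
      omega
    · simp

end CyclicCarry

theorem carry_counting (p t : ℕ) (hp : p.Prime) (hodd : Odd p) (ht : 0 < t)
    (hq : p^t % 4 = 3)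
    (s : ℕ → ℕ) (hs : ∀ n, s n = (Nat.digits p n).sum)
    (c : ℕ → ℕ)
    (hc : ∀ i, c i = (s i + s ((p^t - 1)/2)
      - s ((i + (p^t - 1)/2) % (p^t - 1))) / (p - 1)) :
    (((Finset.Icc 1 (p^t - 2)).filter
        (fun i => i ≠ (p^t - 1)/2 ∧ c i = t)).card = ((p+1)/2)^t - 2) ∧
    (∀ a, 1 ≤ a → a < t →
      ((((Finset.Icc 1 (p^t - 2)).filter
          (fun i => i ≠ (p^t - 1)/2 ∧ c i = a)).card : ℚ) =
        ∑ j ∈ Finset.range (min a (t - a) + 1),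
          (t : ℚ) / ((t - j : ℕ) : ℚ) * ((t - j).choose j : ℚ)
            * ((t - 2*j).choose (a - j) : ℚ)
            * (-(p:ℚ))^j * (((p+1)/2 : ℕ) : ℚ)^(t - 2*j))) := by
  obtain ⟨h, rfl⟩ := hodd
  have hh : 0 < h := by
    have := hp.two_le
    omega
  have hrep := CyclicCarry.repdigit_mul_pred (2 * h + 1) h t (by omega)
  have hpos : 1 ≤ (2 * h + 1) ^ t := Nat.one_le_pow _ _ (by omega)
  have hq' : (2 * h + 1) ^ t = 2 * CyclicCarry.repdigit (2 * h + 1) h t + 1 := by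
    have : h * (2 * CyclicCarry.repdigit (2 * h + 1) h t) = h * ((2 * h + 1) ^ t - 1) := by
      rw [← hrep, Nat.add_sub_cancel]
      ring
    have := Nat.eq_of_mul_eq_mul_left hh this
    omega
  have hk : ((2 * h + 1) ^ t - 1) / 2 = CyclicCarry.repdigit (2 * h + 1) h t := by omega
  have hm : (2 * h + 1) ^ t - 1 = 2 * CyclicCarry.repdigit (2 * h + 1) h t := by omega
  have hm' : (2 * h + 1) ^ t - 2 = 2 * CyclicCarry.repdigit (2 * h + 1) h t - 1 := by omega
  have hh1 : (2 * h + 1 + 1) / 2 = h + 1 := by omega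
  simp only [hs, hk, Nat.add_sub_cancel] at hc
  simp only [hm] at hc
  have key := CyclicCarry.card_add_eq_coeff h t hh ht c hc hq'
  rw [hk, hm', hh1]
  constructor
  · have := key t ht
    rw [CyclicCarry.coeff_carryPoly_trace h t t ht,
      sum_eq_single_of_mem 0 (by simpa using ht)] at this
    · have ht0 : (t : ℚ) ≠ 0 := by positivity
      simp only [if_true, Nat.sub_zero, div_self ht0, Nat.choose_zero_right, mul_zero,
        Nat.choose_self, Nat.zero_le, pow_zero, Nat.cast_one, one_mul] at this
      norm_cast at this
      exact Nat.eq_sub_of_add_eq this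
    · intro j hj hj0
      rw [mem_range] at hj
      rw [Nat.choose_eq_zero_of_lt (show t - 2 * j < t - j by omega)]
      simp
  · intro a ha hat
    have := key a ha
    rw [if_neg hat.ne, add_zero, CyclicCarry.coeff_carryPoly_trace h t a ht] at this
    rw [this]
    symm
    refine sum_subset_zero_on_sdiff ?_ ?_ ?_
    · intro j
      simp only [mem_range]
      omega
    · intro j hj
      simp only [mem_sdiff, mem_range] at hj
      split_ifs with hja
      · by_cases htj : 2 * j ≤ t
        · rw [Nat.choose_eq_zero_of_lt (show t - 2 * j < a - j by omega)]
          simp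
        · rw [Nat.choose_eq_zero_of_lt (show t - j < j by omega)]
          simp
      · rfl
    · intro j hj
      rw [mem_range] at hj
      have hja : j ≤ a := by omega
      rw [if_pos hja]
end

section
/- Let λ be a positive integer and let M be the adjacency matrix of a doubly-regular tournament with parameters (4λ+3, 2λ+1, λ). Define the (4λ+4)×(4λ+4) integer matrix H in block form by: the (0,0) entry is 1, the rest of row 0 consists of 1's, the rest of column 0 consists of −1's, and the remaining (4λ+3)×(4λ+3) block is J − 2M (where J is the all-ones matrix). Then H is a skew Hadamard matrix: H·Hᵀ = (4λ+4)·I and H + Hᵀ = 2·I. -/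
open Matrix

/-- The row sums of a zero-one matrix are the diagonal entries of `M * Mᵀ`. -/
theorem sum_row_eq_mul_transpose_diag {n : Type*} [Fintype n] (M : Matrix n n ℤ)
    (hM01 : ∀ i j, M i j = 0 ∨ M i j = 1) (i : n) :
    ∑ j, M i j = (M * Mᵀ) i i := by
  simp only [mul_apply, transpose_apply]
  refine Finset.sum_congr rfl fun j _ => ?_
  rcases hM01 i j with h | h <;> simp [h]

theorem drt_skew_hadamard (lam : ℕ) (hlam : 0 < lam)
    (M : Matrix (Fin (4*lam+3)) (Fin (4*lam+3)) ℤ)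
    (hM01 : ∀ i j, M i j = 0 ∨ M i j = 1)
    (hMdiag : ∀ i, M i i = 0)
    (hMskew : M + Mᵀ = Matrix.of (fun _ _ => 1) - 1)
    (hMMt : M * Mᵀ = ((lam : ℤ) + 1) • (1 : Matrix (Fin (4*lam+3)) (Fin (4*lam+3)) ℤ)
      + (lam : ℤ) • Matrix.of (fun _ _ => 1))
    (H : Matrix (Unit ⊕ Fin (4*lam+3)) (Unit ⊕ Fin (4*lam+3)) ℤ)
    (hH : H = Matrix.fromBlocks (1 : Matrix Unit Unit ℤ) (Matrix.of fun _ _ => 1)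
      (Matrix.of fun _ _ => -1) (Matrix.of (fun _ _ => 1) - 2 • M)) :
    H * Hᵀ = (4*(lam:ℤ)+4) • (1 : Matrix (Unit ⊕ Fin (4*lam+3)) (Unit ⊕ Fin (4*lam+3)) ℤ)
      ∧ H + Hᵀ = 2 • (1 : Matrix (Unit ⊕ Fin (4*lam+3)) (Unit ⊕ Fin (4*lam+3)) ℤ) := by
  have hrow (i) : ∑ j, M i j = 2 * (lam : ℤ) + 1 := by
    rw [sum_row_eq_mul_transpose_diag M hM01, hMMt, Matrix.add_apply, Matrix.smul_apply,
      Matrix.smul_apply, one_apply_eq, of_apply, smul_eq_mul, smul_eq_mul]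
    ring
  have hprod (i j) : ∑ k, M i k * M j k
      = ((lam : ℤ) + 1) * (1 : Matrix (Fin (4*lam+3)) (Fin (4*lam+3)) ℤ) i j + lam := by
    have h : (M * Mᵀ) i j = _ := congrArg (fun A => A i j) hMMt
    simpa only [mul_apply, transpose_apply, Matrix.add_apply, Matrix.smul_apply, of_apply,
      smul_eq_mul, mul_one] using h
  have hlin (i) : ∑ k, (1 - 2 * M i k) = 1 := by
    rw [Finset.sum_sub_distrib, ← Finset.mul_sum, hrow]
    simp
    ring
  have hquad (i j) : ∑ k, (1 - 2 * M i k) * (1 - 2 * M j k)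
      = 4 * ((lam : ℤ) + 1) * (1 : Matrix (Fin (4*lam+3)) (Fin (4*lam+3)) ℤ) i j - 1 := by
    have hexpand (k) : (1 - 2 * M i k) * (1 - 2 * M j k)
        = (1 - 2 * M i k) - 2 * M j k + 4 * (M i k * M j k) := by ring
    simp only [hexpand, Finset.sum_add_distrib, Finset.sum_sub_distrib (fun k => 1 - 2 * M i k),
      hlin, ← Finset.mul_sum, hrow, hprod]
    ring
  have hsymm (i j) : M i j + M j i
      = 1 - (1 : Matrix (Fin (4*lam+3)) (Fin (4*lam+3)) ℤ) i j :=
    congrArg (fun A => A i j) hMskew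
  have hcorner : H (.inl ()) (.inl ()) = 1 := by rw [hH]; rfl
  have htop (j) : H (.inl ()) (.inr j) = 1 := by rw [hH]; rfl
  have hleft (i) : H (.inr i) (.inl ()) = -1 := by rw [hH]; rfl
  have hblock (i j) : H (.inr i) (.inr j) = 1 - 2 * M i j := by
    rw [hH, fromBlocks_apply₂₂, Matrix.sub_apply, Matrix.smul_apply, of_apply, nsmul_eq_mul,
      Nat.cast_ofNat]
  constructor
  · ext (⟨⟩ | i) (⟨⟩ | j)
    · simp [mul_apply, hcorner, htop]
      ring
    · simp [mul_apply, hcorner, htop, hleft, hblock, hlin]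
    · simp [mul_apply, hcorner, htop, hleft, hblock, hlin]
    · simp [mul_apply, hleft, hblock, hquad, one_apply, mul_add]
  · ext (⟨⟩ | i) (⟨⟩ | j)
    · simp [hcorner]
    · simp [htop, hleft]
    · simp [htop, hleft]
    · have h := hsymm i j
      simp only [Matrix.add_apply, transpose_apply, hblock, Matrix.smul_apply, one_apply,
        Sum.inr.injEq, nsmul_eq_mul, Nat.cast_ofNat] at h ⊢
      linarith
end
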